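/- arXiv:1804.04498 — 6 statements merged into one kernel-verified Lean document; each statement's English description precedes it below -/
import Mathlib

section
/- For all n >= 0, E_{2n+1}/(2n+1)! = sum_{k=0}^{infinity} (2 / ((k+1/2)^2 * pi^2)) * (1 / ((k+1/2)^2 * pi^2))^n. -/
open Real MeasureTheory

lemma aux_hsR {f g : ℕ → ℝ} {a b : ℝ} (h : HasSum f a) (hf : ∀ n, g n = f n) (ha : b = a) :
    HasSum g b := by
  have : g = f := funext hf
  rw [this, ha]; exact h

lemma aux_hsC {f g : ℕ → ℂ} {a b : ℂ} (h : HasSum f a) (hf : ∀ n, g n = f n) (ha : b = a) :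
    HasSum g b := by
  have : g = f := funext hf
  rw [this, ha]; exact h

lemma aux_notInt (x : ℝ) (h0 : 0 < x) (h1 : x < 1) : (x : ℂ) ∈ Complex.integerComplement := by
  rintro ⟨m, hm⟩
  have hm' : (m : ℝ) = x := by exact_mod_cast hm
  rw [← hm'] at h0 h1
  have a : 0 < m := by exact_mod_cast h0
  have b : m < 1 := by exact_mod_cast h1
  omega

lemma aux_cot_hasSum {x : ℂ} (hx : x ∈ Complex.integerComplement) :
    HasSum (fun n => cotTerm x n) (π * Complex.cot (π * x) - 1 / x) := by
  rw [cot_series_rep' hx]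
  exact (summable_cotTerm hx).hasSum

lemma aux_tan_complex (x : ℝ) (h0 : 0 < x) (h1 : x < 1 / 2) :
    HasSum (fun j : ℕ => -2 * cotTerm (2 * (x : ℂ)) (2 * j)) (π * Complex.tan (π * x)) := by
  have hx := aux_notInt x h0 (by linarith)
  have hx2 : (2 * (x : ℂ)) ∈ Complex.integerComplement := by
    have := aux_notInt (2 * x) (by linarith) (by linarith)
    push_cast at this
    exact this
  have A := aux_cot_hasSum hx
  have B := aux_cot_hasSum hx2
  have hS : Summable (fun j : ℕ => cotTerm (2 * (x : ℂ)) (2 * j)) :=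
    B.summable.comp_injective (mul_right_injective₀ (two_ne_zero' ℕ))
  have hodd : HasSum (fun j : ℕ => cotTerm (2 * (x : ℂ)) (2 * j + 1))
      ((1 / 2) * (π * Complex.cot (π * x) - 1 / x)) := by
    refine aux_hsC (A.mul_left (1 / 2)) ?_ rfl
    intro j
    simp only [cotTerm]
    have e1 : (2 * (x : ℂ) - (((2 * j + 1 : ℕ) : ℂ) + 1)) = 2 * (x - (j + 1)) := by
      push_cast; ring
    have e2 : (2 * (x : ℂ) + (((2 * j + 1 : ℕ) : ℂ) + 1)) = 2 * (x + (j + 1)) := by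
      push_cast; ring
    rw [e1, e2]
    simp only [one_div, mul_inv]
    ring
  have hB := (hS.hasSum.even_add_odd (f := fun n => cotTerm (2 * (x : ℂ)) n) hodd).unique B
  have key := hS.hasSum.mul_left (-2)
  refine aux_hsC key (fun _ => rfl) ?_
  have hval : (∑' j : ℕ, cotTerm (2 * (x : ℂ)) (2 * j)) =
      π * Complex.cot (π * (2 * x)) - 1 / (2 * x)
        - (1 / 2) * (π * Complex.cot (π * x) - 1 / x) := by
    rw [← hB]; ring
  rw [hval]
  have hx0 : (x : ℂ) ≠ 0 := by exact_mod_cast h0.ne'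
  have hs : Complex.sin (π * x) ≠ 0 := sin_pi_mul_ne_zero hx
  have hc : Complex.cos (π * x) ≠ 0 := by
    have : Real.cos (π * x) ≠ 0 := by
      apply ne_of_gt
      apply Real.cos_pos_of_mem_Ioo
      constructor <;> nlinarith [Real.pi_pos]
    exact_mod_cast this
  have e : (π : ℂ) * (2 * x) = 2 * (π * x) := by ring
  rw [e, Complex.cot, Complex.cot, Complex.tan, Complex.sin_two_mul, Complex.cos_two_mul]
  have hsq := Complex.sin_sq_add_cos_sq (π * x)
  field_simp
  linear_combination ((π : ℂ) * x) * hsq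

lemma aux_pos (t : ℝ) (h0 : 0 < t) (h1 : t < π / 2) (k : ℕ) :
    t ^ 2 < ((k : ℝ) + 1 / 2) ^ 2 * π ^ 2 := by
  rw [← mul_pow]
  have hk : (0 : ℝ) ≤ k := k.cast_nonneg
  have : t < ((k : ℝ) + 1 / 2) * π := by nlinarith [Real.pi_pos]
  gcongr

lemma aux_tan_real (t : ℝ) (h0 : 0 < t) (h1 : t < π / 2) :
    HasSum (fun k : ℕ => 2 * t / (((k : ℝ) + 1 / 2) ^ 2 * π ^ 2 - t ^ 2)) (Real.tan t) := by
  have hpi := Real.pi_pos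
  have H := aux_tan_complex (t / π) (by positivity) (by rw [div_lt_iff₀ hpi]; linarith)
  have e : (π : ℂ) * ((t / π : ℝ) : ℂ) = (t : ℂ) := by
    rw [← Complex.ofReal_mul]; congr 1; field_simp
  rw [e] at H
  have H2 := H.mul_left (1 / (π : ℂ))
  have hpc : (π : ℂ) ≠ 0 := by exact_mod_cast hpi.ne'
  rw [← mul_assoc, one_div_mul_cancel hpc, one_mul, ← Complex.ofReal_tan] at H2
  rw [← Complex.hasSum_ofReal]
  refine aux_hsC H2 (fun k => ?_) rfl
  have hp := aux_pos t h0 h1 k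
  have hk : (0 : ℝ) ≤ k := k.cast_nonneg
  have hA : t < ((k : ℝ) + 1 / 2) * π := by nlinarith [Real.pi_pos]
  have n1 : 2 * (t / π) - (2 * (k : ℝ) + 1) ≠ 0 := by
    have : t / π < k + 1 / 2 := by rw [div_lt_iff₀ hpi]; exact hA
    apply ne_of_lt; linarith
  have n2 : 2 * (t / π) + (2 * (k : ℝ) + 1) ≠ 0 := by positivity
  have n3 : ((k : ℝ) + 1 / 2) ^ 2 * π ^ 2 - t ^ 2 ≠ 0 := by linarith
  have R : 2 * t / (((k : ℝ) + 1 / 2) ^ 2 * π ^ 2 - t ^ 2) =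
      1 / π * (-2 * (1 / (2 * (t / π) - (2 * (k : ℝ) + 1)) + 1 / (2 * (t / π) + (2 * (k : ℝ) + 1)))) := by
    rw [one_div_add_one_div n1 n2]
    have n4 : (2 * (t / π) - (2 * (k : ℝ) + 1)) * (2 * (t / π) + (2 * (k : ℝ) + 1)) =
        -4 / π ^ 2 * (((k : ℝ) + 1 / 2) ^ 2 * π ^ 2 - t ^ 2) := by
      field_simp; ring
    rw [n4]
    generalize ((k : ℝ) + 1 / 2) ^ 2 * π ^ 2 - t ^ 2 = D at n3
    field_simp
    ring
  rw [R]
  simp only [cotTerm]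
  push_cast
  rfl

lemma aux_series (t : ℝ) (h0 : 0 < t) (h1 : t < π / 2) :
    HasSum (fun n : ℕ => (∑' k : ℕ, (2 / (((k : ℝ) + 1 / 2) ^ 2 * π ^ 2)) *
            (1 / (((k : ℝ) + 1 / 2) ^ 2 * π ^ 2)) ^ n) * t ^ (2 * n + 1)) (Real.tan t) := by
  set f : ℕ × ℕ → ℝ := fun p => (2 / (((p.1 : ℝ) + 1 / 2) ^ 2 * π ^ 2)) *
            (1 / (((p.1 : ℝ) + 1 / 2) ^ 2 * π ^ 2)) ^ p.2 * t ^ (2 * p.2 + 1) with hf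
  have hf0 : 0 ≤ f := fun p => by simp only [hf, Pi.zero_apply]; positivity
  have hrow : ∀ k : ℕ, HasSum (fun n => f (k, n))
      (2 * t / (((k : ℝ) + 1 / 2) ^ 2 * π ^ 2 - t ^ 2)) := by
    intro k
    have hp := aux_pos t h0 h1 k
    simp only [hf]
    generalize ((k : ℝ) + 1 / 2) ^ 2 * π ^ 2 = D at hp
    have hD : 0 < D := lt_trans (by positivity) hp
    have hg := (hasSum_geometric_of_lt_one (r := t ^ 2 / D) (by positivity)
      (by rw [div_lt_one hD]; exact hp)).mul_left (2 * t / D)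
    refine aux_hsR hg (fun n => ?_) ?_
    · rw [div_pow, div_pow, one_pow]; field_simp; ring
    · have : D - t ^ 2 ≠ 0 := by linarith
      have h3 : 1 - t ^ 2 / D = (D - t ^ 2) / D := by field_simp
      rw [h3]; field_simp
  have hT := aux_tan_real t h0 h1
  have hS : Summable f := by
    rw [summable_prod_of_nonneg hf0]
    refine ⟨fun k => (hrow k).summable, ?_⟩
    simp_rw [fun k => (hrow k).tsum_eq]
    exact hT.summable
  have hv : ∑' p, f p = Real.tan t := by
    rw [hS.tsum_prod]
    simp_rw [fun k => (hrow k).tsum_eq]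
    exact hT.tsum_eq
  have hS' : HasSum (fun p : ℕ × ℕ => f p.swap) (Real.tan t) := by
    have := (Equiv.prodComm ℕ ℕ).hasSum_iff.2 hS.hasSum
    rw [hv] at this
    exact this
  have := hS'.prod_fiberwise (fun n => (hS'.summable.prod_factor n).hasSum)
  refine aux_hsR this (fun n => ?_) rfl
  rw [← tsum_mul_right]
  rfl

theorem tangent_numbers_partial_fraction (E : ℕ → ℝ)
    (hE : ∀ t : ℝ, |t| < π / 2 →
      HasSum (fun n : ℕ => E (2 * n + 1) * t ^ (2 * n + 1) / ((2 * n + 1).factorial : ℝ))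
        (Real.tan t)) :
    ∀ n : ℕ,
      E (2 * n + 1) / ((2 * n + 1).factorial : ℝ) =
        ∑' k : ℕ,
          (2 / (((k : ℝ) + 1 / 2) ^ 2 * π ^ 2)) *
            (1 / (((k : ℝ) + 1 / 2) ^ 2 * π ^ 2)) ^ n := by
  set c : ℕ → ℝ := fun n => ∑' k : ℕ, (2 / (((k : ℝ) + 1 / 2) ^ 2 * π ^ 2)) *
            (1 / (((k : ℝ) + 1 / 2) ^ 2 * π ^ 2)) ^ n with hc
  set d : ℕ → ℝ := fun n => E (2 * n + 1) / ((2 * n + 1).factorial : ℝ) - c n with hd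
  have hpos : ∀ t : ℝ, 0 < t → t < π / 2 → HasSum (fun n => d n * t ^ (2 * n + 1)) 0 := by
    intro t h0 h1
    have := (hE t (by rwa [abs_of_pos h0])).sub (aux_series t h0 h1)
    rw [sub_self] at this
    refine aux_hsR this (fun n => ?_) rfl
    simp only [hd, hc]; ring
  have hall : ∀ t : ℝ, |t| < π / 2 → HasSum (fun n => d n * t ^ (2 * n + 1)) 0 := by
    intro t ht
    rcases lt_trichotomy t 0 with h | h | h
    · have := (hpos (-t) (by linarith) (by rwa [abs_of_neg h] at ht)).neg
      rw [neg_zero] at this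
      refine aux_hsR this (fun n => ?_) rfl
      rw [Odd.neg_pow ⟨n, rfl⟩]; ring
    · subst h
      simp
    · exact hpos t h (by rwa [abs_of_pos h] at ht)
  set b : ℕ → ℝ := fun m => if Odd m then d (m / 2) else 0 with hb
  have hb1 : ∀ n, b (2 * n + 1) = d n := by
    intro n
    have : (2 * n + 1) / 2 = n := by omega
    simp [hb, this]
  have hser : HasFPowerSeriesAt (0 : ℝ → ℝ) (FormalMultilinearSeries.ofScalars ℝ b) 0 := by
    rw [hasFPowerSeriesAt_iff]
    have hev : ∀ᶠ t : ℝ in nhds 0, |t| < π / 2 := by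
      have : Metric.ball (0 : ℝ) (π / 2) ∈ nhds 0 := Metric.ball_mem_nhds _ (by positivity)
      filter_upwards [this] with t ht
      simpa using ht
    filter_upwards [hev] with t ht
    have hinj : Function.Injective (fun n : ℕ => 2 * n + 1) := fun a b h => by
      simp only at h; omega
    refine (hinj.hasSum_iff ?_).1 ?_
    · intro m hm
      have : ¬ Odd m := fun ⟨j, hj⟩ => hm ⟨j, hj.symm⟩
      simp [hb, this, FormalMultilinearSeries.coeff_ofScalars]
    · refine aux_hsR (hall t ht) (fun n => ?_) rfl
      simp only [Function.comp, FormalMultilinearSeries.coeff_ofScalars, hb1, smul_eq_mul]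
      ring
  have hz := hser.eq_zero
  intro n
  have h1 : b (2 * n + 1) = 0 := by
    rw [← FormalMultilinearSeries.coeff_ofScalars (𝕜 := ℝ) (p := b), hz]
    simp [FormalMultilinearSeries.coeff]
  rw [hb1] at h1
  exact sub_eq_zero.1 h1
end

section
/- Let mu and nu be signed measures on R representing the same moment sequence (a_n)_{n>=0}; if mu satisfies integral e^{epsilon|x|} d|mu|(x) < infinity for some epsilon > 0, and nu either is a positive measure or also has exponential decay of this type, then mu = nu. -/
open Real MeasureTheory

lemma aux_lintegral_cosh (P : Measure ℝ) (ε : ℝ) :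
    ∫⁻ x, ENNReal.ofReal (Real.cosh (ε * x)) ∂P =
      ∑' n : ℕ, ∫⁻ x, ENNReal.ofReal ((ε * x) ^ (2 * n) / ((2 * n).factorial : ℝ)) ∂P := by
  rw [← lintegral_tsum (fun n => by fun_prop)]
  congr 1
  ext x
  have h := Real.hasSum_cosh (ε * x)
  rw [← h.tsum_eq, ENNReal.ofReal_tsum_of_nonneg _ h.summable]
  intro n
  have : 0 ≤ (ε * x) ^ (2 * n) := by rw [pow_mul]; positivity
  positivity

lemma aux_term (P : Measure ℝ) (ε : ℝ) (n : ℕ)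
    (hP : Integrable (fun x : ℝ => |x| ^ (2 * n)) P) :
    ∫⁻ x, ENNReal.ofReal ((ε * x) ^ (2 * n) / ((2 * n).factorial : ℝ)) ∂P =
      ENNReal.ofReal (ε ^ (2 * n) / ((2 * n).factorial : ℝ) * ∫ x, x ^ (2 * n) ∂P) := by
  have hP' : Integrable (fun x : ℝ => x ^ (2 * n)) P := by
    refine hP.congr (Filter.Eventually.of_forall fun x => ?_)
    simp only [pow_mul, sq_abs]
  rw [← integral_const_mul, ofReal_integral_eq_lintegral_ofReal (hP'.const_mul _)]
  · congr 1
    ext x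
    congr 1
    rw [mul_pow]; ring
  · refine Filter.Eventually.of_forall fun x => ?_
    have h1 : 0 ≤ x ^ (2 * n) := by rw [pow_mul]; positivity
    have h2 : 0 ≤ ε ^ (2 * n) := by rw [pow_mul]; positivity
    simp only [Pi.zero_apply]
    positivity

lemma aux_decay (P T : Measure ℝ) (ε : ℝ) (hε : 0 < ε)
    (hP : ∀ n : ℕ, Integrable (fun x : ℝ => |x| ^ n) P)
    (hT : ∀ n : ℕ, Integrable (fun x : ℝ => |x| ^ n) T)
    (hle : ∀ n : ℕ, ∫ x, x ^ (2 * n) ∂P ≤ ∫ x, x ^ (2 * n) ∂T)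
    (hTe : Integrable (fun x : ℝ => Real.exp (ε * |x|)) T) :
    Integrable (fun x : ℝ => Real.exp (ε * |x|)) P := by
  have hc : ∀ x : ℝ, Real.cosh (ε * x) = Real.cosh (ε * |x|) := by
    intro x
    rcases abs_choice x with h | h <;> rw [h]
    rw [mul_neg, Real.cosh_neg]
  have key : ∫⁻ x, ENNReal.ofReal (Real.cosh (ε * x)) ∂P ≤
      ∫⁻ x, ENNReal.ofReal (Real.cosh (ε * x)) ∂T := by
    rw [aux_lintegral_cosh, aux_lintegral_cosh]
    refine ENNReal.tsum_le_tsum fun n => ?_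
    rw [aux_term _ _ _ (hP _), aux_term _ _ _ (hT _)]
    refine ENNReal.ofReal_le_ofReal (mul_le_mul_of_nonneg_left (hle n) ?_)
    have h2 : 0 ≤ ε ^ (2 * n) := by rw [pow_mul]; positivity
    positivity
  have hTc : Integrable (fun x : ℝ => Real.cosh (ε * x)) T := by
    · refine hTe.mono' (by fun_prop) (Filter.Eventually.of_forall fun x => ?_)
      rw [hc, Real.norm_of_nonneg (Real.cosh_pos _).le, Real.cosh_eq]
      have : Real.exp (-(ε * |x|)) ≤ Real.exp (ε * |x|) := by
        apply Real.exp_le_exp.2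
        have : 0 ≤ ε * |x| := by positivity
        linarith
      linarith
  have hfin : ∫⁻ x, ENNReal.ofReal (Real.cosh (ε * x)) ∂P < ⊤ := by
    refine lt_of_le_of_lt key ?_
    rw [← ofReal_integral_eq_lintegral_ofReal hTc
      (Filter.Eventually.of_forall fun x => (Real.cosh_pos _).le)]
    exact ENNReal.ofReal_lt_top
  have hPc : Integrable (fun x : ℝ => Real.cosh (ε * x)) P := by
    refine ⟨by fun_prop, ?_⟩
    rw [hasFiniteIntegral_iff_ofReal
      (Filter.Eventually.of_forall fun x => (Real.cosh_pos _).le)]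
    exact hfin
  refine (hPc.const_mul 2).mono' (by fun_prop) (Filter.Eventually.of_forall fun x => ?_)
  rw [hc, Real.norm_of_nonneg (Real.exp_pos _).le, Real.cosh_eq]
  have := Real.exp_pos (-(ε * |x|))
  linarith

open ProbabilityTheory in
lemma aux_mem (P : Measure ℝ) (δ : ℝ)
    (hPe : Integrable (fun x : ℝ => Real.exp (δ * |x|)) P) :
    Set.Ioo (-δ) δ ⊆ interior (integrableExpSet id P) := by
  rw [isOpen_Ioo.subset_interior_iff]
  intro t ht
  have : Integrable (fun x : ℝ => Real.exp (t * x)) P := by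
    refine hPe.mono' (by fun_prop) (Filter.Eventually.of_forall fun x => ?_)
    rw [Real.norm_of_nonneg (Real.exp_pos _).le]
    apply Real.exp_le_exp.2
    calc t * x ≤ |t * x| := le_abs_self _
      _ = |t| * |x| := abs_mul _ _
      _ ≤ δ * |x| := by
        gcongr
        exact (abs_lt.2 ht).le
  exact this

open ProbabilityTheory in
lemma aux_unique (P Q : Measure ℝ) [IsFiniteMeasure P] [IsFiniteMeasure Q] (δ : ℝ) (hδ : 0 < δ)
    (hPe : Integrable (fun x : ℝ => Real.exp (δ * |x|)) P)
    (hQe : Integrable (fun x : ℝ => Real.exp (δ * |x|)) Q)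
    (h : ∀ n : ℕ, ∫ x, x ^ n ∂P = ∫ x, x ^ n ∂Q) : P = Q := by
  have hP := aux_mem P δ hPe
  have hQ := aux_mem Q δ hQe
  have h0 : (0 : ℂ).re ∈ Set.Ioo (-δ) δ := by simp [hδ]
  let U : Set ℂ := {z | z.re ∈ Set.Ioo (-δ) δ}
  have hU : IsPreconnected U :=
    ((convex_Ioo (-δ) δ).is_linear_preimage Complex.reLm.isLinear).isPreconnected
  have hPa : AnalyticOnNhd ℂ (complexMGF id P) U :=
    analyticOnNhd_complexMGF.mono fun z hz => hP hz
  have hQa : AnalyticOnNhd ℂ (complexMGF id Q) U :=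
    analyticOnNhd_complexMGF.mono fun z hz => hQ hz
  have hd : ∀ n, iteratedDeriv n (complexMGF id P) 0 = iteratedDeriv n (complexMGF id Q) 0 := by
    intro n
    rw [iteratedDeriv_complexMGF (hP h0), iteratedDeriv_complexMGF (hQ h0)]
    simp only [id, zero_mul, Complex.exp_zero, mul_one, ← Complex.ofReal_pow]
    rw [integral_complex_ofReal, integral_complex_ofReal, h n]
  have hev : complexMGF id P =ᶠ[nhds 0] complexMGF id Q := by
    have e1 := (hPa 0 h0).hasFPowerSeriesAt.eventually_hasSum_sub
    have e2 := (hQa 0 h0).hasFPowerSeriesAt.eventually_hasSum_sub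
    simp only [hd] at e1
    filter_upwards [e1, e2] with z h1 h2 using h1.unique h2
  have hEq := hPa.eqOn_of_preconnected_of_eventuallyEq hQa hU h0 hev
  refine Measure.ext_of_charFun ?_
  ext t
  rw [← complexMGF_id_mul_I, ← complexMGF_id_mul_I]
  apply hEq
  simp [U, hδ]

lemma aux_mono (P : Measure ℝ) (ε δ : ℝ) (h : δ ≤ ε)
    (hPe : Integrable (fun x : ℝ => Real.exp (ε * |x|)) P) :
    Integrable (fun x : ℝ => Real.exp (δ * |x|)) P := by
  refine hPe.mono' (by fun_prop) (Filter.Eventually.of_forall fun x => ?_)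
  rw [Real.norm_of_nonneg (Real.exp_pos _).le]
  apply Real.exp_le_exp.2
  gcongr

lemma aux_pow (P : Measure ℝ) (n : ℕ) (h : Integrable (fun x : ℝ => |x| ^ n) P) :
    Integrable (fun x : ℝ => x ^ n) P :=
  h.mono' (by fun_prop) (Filter.Eventually.of_forall fun x => by simp)

lemma aux_neg (ν : SignedMeasure ℝ) (h : 0 ≤ ν) : ν.toJordanDecomposition.negPart = 0 := by
  obtain ⟨A, hA, h1, h2⟩ := ν.toJordanDecomposition.mutuallySingular
  have h3 := ν.apply_eq_posPart_real_sub_negPart_real hA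
  have h4 : 0 ≤ ν A := by simpa using h A hA
  have h5 : ν.toJordanDecomposition.negPart.real A = 0 := by
    have h6 : ν.toJordanDecomposition.posPart.real A = 0 := by simp [measureReal_def, h1]
    have h7 : 0 ≤ ν.toJordanDecomposition.negPart.real A := measureReal_nonneg
    linarith
  rw [measureReal_eq_zero_iff] at h5
  rw [← Measure.measure_univ_eq_zero, ← Set.union_compl_self A]
  exact measure_union_null h5 h2

theorem uniqueness_exponential_decay
    (μ ν : MeasureTheory.SignedMeasure ℝ) (a : ℕ → ℝ) (ε : ℝ) (hε : 0 < ε)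
    (hμint : ∀ n : ℕ, Integrable (fun x : ℝ => |x| ^ n) μ.totalVariation)
    (hνint : ∀ n : ℕ, Integrable (fun x : ℝ => |x| ^ n) ν.totalVariation)
    (hμa : ∀ n : ℕ, a n =
      (∫ x : ℝ, x ^ n ∂μ.toJordanDecomposition.posPart) -
        ∫ x : ℝ, x ^ n ∂μ.toJordanDecomposition.negPart)
    (hνa : ∀ n : ℕ, a n =
      (∫ x : ℝ, x ^ n ∂ν.toJordanDecomposition.posPart) -
        ∫ x : ℝ, x ^ n ∂ν.toJordanDecomposition.negPart)
    (hμdecay : Integrable (fun x : ℝ => Real.exp (ε * |x|)) μ.totalVariation)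
    (hν : 0 ≤ ν ∨ ∃ ε' : ℝ, 0 < ε' ∧
      Integrable (fun x : ℝ => Real.exp (ε' * |x|)) ν.totalVariation) :
    μ = ν := by
  have hμi := fun n => integrable_add_measure.1 (aux_pow _ n (hμint n))
  have hνi := fun n => integrable_add_measure.1 (aux_pow _ n (hνint n))
  have hν' : ∃ ε' : ℝ, 0 < ε' ∧
      Integrable (fun x : ℝ => Real.exp (ε' * |x|)) ν.totalVariation := by
    rcases hν with h | h
    · refine ⟨ε, hε, aux_decay _ μ.totalVariation ε hε hνint hμint ?_ hμdecay⟩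
      intro n
      have hn := aux_neg ν h
      have h1 := hμa (2 * n)
      have h2 := hνa (2 * n)
      rw [hn] at h2
      simp only [integral_zero_measure, sub_zero] at h2
      unfold SignedMeasure.totalVariation
      rw [hn, add_zero, integral_add_measure (hμi _).1 (hμi _).2]
      have h3 : 0 ≤ ∫ x : ℝ, x ^ (2 * n) ∂μ.toJordanDecomposition.negPart := by
        refine integral_nonneg fun x => ?_
        simp only [Pi.zero_apply, pow_mul]
        positivity
      linarith
    · exact h
  obtain ⟨ε', hε', hνdecay⟩ := hν'
  have d1 := integrable_add_measure.1 (aux_mono _ ε (min ε ε') (min_le_left _ _) hμdecay)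
  have d2 := integrable_add_measure.1 (aux_mono _ ε' (min ε ε') (min_le_right _ _) hνdecay)
  have key : μ.toJordanDecomposition.posPart + ν.toJordanDecomposition.negPart =
      ν.toJordanDecomposition.posPart + μ.toJordanDecomposition.negPart := by
    refine aux_unique _ _ (min ε ε') (lt_min hε hε') (d1.1.add_measure d2.2)
      (d2.1.add_measure d1.2) fun n => ?_
    rw [integral_add_measure (hμi n).1 (hνi n).2, integral_add_measure (hνi n).1 (hμi n).2]
    have := hμa n
    have := hνa n
    linarith
  ext A hA
  rw [μ.apply_eq_posPart_real_sub_negPart_real hA, ν.apply_eq_posPart_real_sub_negPart_real hA]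
  have h := congrArg (fun m : Measure ℝ => m.real A) key
  beta_reduce at h
  rw [measureReal_add_apply, measureReal_add_apply] at h
  linarith
end

section
/- If a sequence of real numbers (a_n)_{n>=0} satisfies |a_n| <= A * B^n * n! for some constants A, B < infinity, then there is at most one positive measure mu on R with a_n = integral x^n dmu(x) for all n. -/
open Real MeasureTheory

lemma aux_integrable_exp (A B : ℝ) (μ : Measure ℝ)
    (hi : ∀ n : ℕ, Integrable (fun x : ℝ => x ^ n) μ)
    (hb : ∀ n : ℕ, |∫ x : ℝ, x ^ n ∂μ| ≤ A * B ^ n * n.factorial)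
    (t : ℝ) (ht : |t * B| ≤ 1 / 2) :
    Integrable (fun x : ℝ => Real.exp (t * x)) μ := by
  have hA : 0 ≤ A := by simpa using (abs_nonneg _).trans (hb 0)
  have hcosh : Integrable (fun x : ℝ => Real.cosh (t * x)) μ := by
    refine ⟨(by fun_prop : Continuous fun x : ℝ => Real.cosh (t * x)).aestronglyMeasurable, ?_⟩
    have hnn : ∀ (n : ℕ) (x : ℝ), 0 ≤ (t * x) ^ (2 * n) / ((2 * n).factorial : ℝ) := by
      intro n x
      have : 0 ≤ (t * x) ^ (2 * n) := (even_two_mul n).pow_nonneg _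
      positivity
    have e1 : ∀ x : ℝ, ‖Real.cosh (t * x)‖ₑ
        = ∑' n : ℕ, ENNReal.ofReal ((t * x) ^ (2 * n) / ((2 * n).factorial : ℝ)) := by
      intro x
      rw [Real.enorm_of_nonneg (Real.cosh_pos _).le, ← (Real.hasSum_cosh (t * x)).tsum_eq,
        ENNReal.ofReal_tsum_of_nonneg (fun n => hnn n x) (Real.hasSum_cosh (t * x)).summable]
    unfold HasFiniteIntegral
    simp_rw [e1]
    rw [lintegral_tsum (fun n => by fun_prop)]
    have e2 : ∀ n : ℕ, ∫⁻ x, ENNReal.ofReal ((t * x) ^ (2 * n) / ((2 * n).factorial : ℝ)) ∂μ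
        ≤ ENNReal.ofReal (A * (1 / 4) ^ n) := by
      intro n
      have hint : Integrable (fun x : ℝ => (t * x) ^ (2 * n) / ((2 * n).factorial : ℝ)) μ := by
        simp_rw [mul_pow]
        exact ((hi (2 * n)).const_mul _).div_const _
      rw [← ofReal_integral_eq_lintegral_ofReal hint (ae_of_all _ (hnn n))]
      apply ENNReal.ofReal_le_ofReal
      simp_rw [mul_pow]
      rw [integral_div, integral_const_mul]
      have hf : (0 : ℝ) < ((2 * n).factorial : ℝ) := by positivity
      rw [div_le_iff₀ hf]
      have h1 := (le_abs_self _).trans (hb (2 * n))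
      have h2 : 0 ≤ t ^ (2 * n) := (even_two_mul n).pow_nonneg _
      have h3 : (t * B) ^ (2 * n) ≤ (1 / 4) ^ n := by
        rw [pow_mul]
        apply pow_le_pow_left₀ (sq_nonneg _)
        rw [← sq_abs]
        nlinarith [abs_nonneg (t * B)]
      calc t ^ (2 * n) * ∫ x, x ^ (2 * n) ∂μ
          ≤ t ^ (2 * n) * (A * B ^ (2 * n) * ((2 * n).factorial : ℝ)) := by gcongr
        _ = A * (t * B) ^ (2 * n) * ((2 * n).factorial : ℝ) := by rw [mul_pow]; ring
        _ ≤ _ := by gcongr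
    refine (ENNReal.tsum_le_tsum e2).trans_lt ?_
    rw [← ENNReal.ofReal_tsum_of_nonneg (fun n => by positivity)
      ((summable_geometric_of_lt_one (by norm_num) (by norm_num)).mul_left A)]
    exact ENNReal.ofReal_lt_top
  refine (hcosh.const_mul 2).mono'
    (by fun_prop : Continuous fun x : ℝ => Real.exp (t * x)).aestronglyMeasurable
    (ae_of_all _ fun x => ?_)
  rw [Real.norm_of_nonneg (Real.exp_pos _).le, Real.cosh_eq]
  linarith [Real.exp_pos (-(t * x))]

lemma aux_strip (A B : ℝ) (μ : Measure ℝ)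
    (hi : ∀ n : ℕ, Integrable (fun x : ℝ => x ^ n) μ)
    (hb : ∀ n : ℕ, |∫ x : ℝ, x ^ n ∂μ| ≤ A * B ^ n * n.factorial) :
    Set.Ioo (-(1 / (2 * (|B| + 1)))) (1 / (2 * (|B| + 1))) ⊆
      interior (ProbabilityTheory.integrableExpSet id μ) := by
  apply interior_maximal _ isOpen_Ioo
  intro t ht
  refine aux_integrable_exp A B μ hi hb t ?_
  have h1 : |t| ≤ 1 / (2 * (|B| + 1)) := (abs_lt.mpr ht).le
  have hB := abs_nonneg B
  rw [le_div_iff₀ (by positivity)] at h1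
  rw [abs_mul]
  nlinarith [abs_nonneg t]

theorem at_most_one_representing_positive_measure
    (a : ℕ → ℝ) (A B : ℝ)
    (hbound : ∀ n : ℕ, |a n| ≤ A * B ^ n * n.factorial) :
    ∀ μ ν : Measure ℝ,
      (∀ n : ℕ, Integrable (fun x : ℝ => x ^ n) μ) →
      (∀ n : ℕ, Integrable (fun x : ℝ => x ^ n) ν) →
      (∀ n : ℕ, a n = ∫ x : ℝ, x ^ n ∂μ) →
      (∀ n : ℕ, a n = ∫ x : ℝ, x ^ n ∂ν) →
      μ = ν := by
  intro μ ν hμ hν aμ aν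
  have fin : ∀ ρ : Measure ℝ, (∀ n : ℕ, Integrable (fun x : ℝ => x ^ n) ρ) →
      IsFiniteMeasure ρ := by
    intro ρ h
    have h0 := h 0
    simp only [pow_zero] at h0
    simpa [integrable_const_iff] using h0
  have := fin μ hμ
  have := fin ν hν
  have sμ := aux_strip A B μ hμ (fun n => aμ n ▸ hbound n)
  have sν := aux_strip A B ν hν (fun n => aν n ▸ hbound n)
  have hr : 0 < 1 / (2 * (|B| + 1)) := by positivity
  set r : ℝ := 1 / (2 * (|B| + 1)) with hrdef
  have h0 : (0 : ℝ) ∈ Set.Ioo (-r) r := ⟨by linarith, hr⟩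
  have anμ : AnalyticOnNhd ℂ (ProbabilityTheory.complexMGF id μ) {z | z.re ∈ Set.Ioo (-r) r} :=
    ProbabilityTheory.analyticOnNhd_complexMGF.mono fun z hz => sμ hz
  have anν : AnalyticOnNhd ℂ (ProbabilityTheory.complexMGF id ν) {z | z.re ∈ Set.Ioo (-r) r} :=
    ProbabilityTheory.analyticOnNhd_complexMGF.mono fun z hz => sν hz
  have hball : Metric.ball (0 : ℂ) r ⊆ {z | z.re ∈ Set.Ioo (-r) r} := by
    intro z hz
    exact abs_lt.mp ((Complex.abs_re_le_norm z).trans_lt (by simpa using hz))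
  have key : ∀ n : ℕ, iteratedDeriv n (ProbabilityTheory.complexMGF id μ) 0
      = iteratedDeriv n (ProbabilityTheory.complexMGF id ν) 0 := by
    intro n
    rw [ProbabilityTheory.iteratedDeriv_complexMGF (sμ (by simpa using h0)),
      ProbabilityTheory.iteratedDeriv_complexMGF (sν (by simpa using h0))]
    have h := (aμ n).symm.trans (aν n)
    have h' := congrArg (fun x : ℝ => (x : ℂ)) h
    simp only [← integral_complex_ofReal] at h'
    simpa using h'
  have heq : Set.EqOn (ProbabilityTheory.complexMGF id μ) (ProbabilityTheory.complexMGF id ν)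
      {z | z.re ∈ Set.Ioo (-r) r} := by
    refine anμ.eqOn_of_preconnected_of_eventuallyEq anν
      ((convex_Ioo (-r) r).linear_preimage Complex.reLm).isPreconnected
      (z₀ := 0) (by simpa using h0) ?_
    filter_upwards [Metric.ball_mem_nhds (0 : ℂ) hr] with z hz
    rw [← Complex.taylorSeries_eq_on_ball (anμ.differentiableOn.mono hball) hz,
      ← Complex.taylorSeries_eq_on_ball (anν.differentiableOn.mono hball) hz]
    simp_rw [key]
  apply Measure.ext_of_charFun
  ext t
  have := heq (x := Complex.I * t) (by simpa using h0)
  rw [charFun_apply_real, charFun_apply_real]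
  simp only [ProbabilityTheory.complexMGF, id] at this
  simpa [mul_comm, mul_left_comm, mul_assoc] using this
end

section
/- If (a_n)_{n>=0} is a sequence of real numbers represented by a signed measure mu on R that is not a positive measure and satisfies integral e^{epsilon|x|} d|mu|(x) < infinity for some epsilon > 0, then (a_n) is not a Hamburger moment sequence, i.e., there is no positive measure nu on R with a_n = integral x^n dnu(x) for all n. -/
open Real MeasureTheory

open ProbabilityTheory in
lemma aux_strip_s9 (μ : Measure ℝ) (ε : ℝ)
    (h : Integrable (fun x : ℝ => Real.exp (ε * |x|)) μ) {t : ℝ} (ht : t ∈ Set.Ioo (-ε) ε) :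
    t ∈ interior (integrableExpSet id μ) := by
  have hsub : Set.Ioo (-ε) ε ⊆ integrableExpSet id μ := by
    intro u hu
    refine h.mono' (by fun_prop) (Filter.Eventually.of_forall fun x => ?_)
    simp only [id, Real.norm_eq_abs, abs_exp]
    apply Real.exp_le_exp.2
    calc u * x ≤ |u * x| := le_abs_self _
      _ = |u| * |x| := abs_mul _ _
      _ ≤ ε * |x| := by
        gcongr
        exact (abs_lt.2 ⟨hu.1, hu.2⟩).le
  exact interior_mono hsub (by rwa [isOpen_Ioo.interior_eq])

open ProbabilityTheory in
lemma aux_unique_s9 (μ ν : Measure ℝ) [IsFiniteMeasure μ] [IsFiniteMeasure ν] (ε : ℝ) (hε : 0 < ε)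
    (hμ : Integrable (fun x : ℝ => Real.exp (ε * |x|)) μ)
    (hν : Integrable (fun x : ℝ => Real.exp (ε * |x|)) ν)
    (h : ∀ n : ℕ, ∫ x : ℝ, x ^ n ∂μ = ∫ x : ℝ, x ^ n ∂ν) : μ = ν := by
  have h0 : (0 : ℝ) ∈ Set.Ioo (-ε) ε := ⟨by linarith, hε⟩
  have hd : ∀ n, iteratedDeriv n (complexMGF id μ) 0 = iteratedDeriv n (complexMGF id ν) 0 := by
    intro n
    rw [iteratedDeriv_complexMGF (by simpa using aux_strip_s9 μ ε hμ h0),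
      iteratedDeriv_complexMGF (by simpa using aux_strip_s9 ν ε hν h0)]
    simp only [id, zero_mul, Complex.exp_zero, mul_one]
    have := congrArg (fun r : ℝ => (r : ℂ)) (h n)
    simp only [← integral_complex_ofReal] at this
    simpa using this
  have e : complexMGF id μ =ᶠ[nhds 0] complexMGF id ν := by
    have a1 := (analyticAt_complexMGF (X := id) (μ := μ) (z := 0)
      (by simpa using aux_strip_s9 μ ε hμ h0)).hasFPowerSeriesAt
    have a2 := (analyticAt_complexMGF (X := id) (μ := ν) (z := 0)
      (by simpa using aux_strip_s9 ν ε hν h0)).hasFPowerSeriesAt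
    simp only [hd] at a1
    have a3 := a1.sub a2
    rw [sub_self] at a3
    filter_upwards [a3.eventually_eq_zero] with z hz
    simpa [sub_eq_zero] using hz
  have hon : Set.EqOn (complexMGF id μ) (complexMGF id ν) {z : ℂ | z.re ∈ Set.Ioo (-ε) ε} := by
    refine AnalyticOnNhd.eqOn_of_preconnected_of_eventuallyEq (𝕜 := ℂ) (z₀ := 0)
      (fun z hz => analyticAt_complexMGF (aux_strip_s9 μ ε hμ hz))
      (fun z hz => analyticAt_complexMGF (aux_strip_s9 ν ε hν hz))
      ((convex_Ioo (-ε) ε).linear_preimage Complex.reLm).isPreconnected (by simpa using h0) e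
  apply Measure.ext_of_charFun
  ext t
  rw [← complexMGF_id_mul_I, ← complexMGF_id_mul_I]
  exact hon (by simpa using h0)

lemma aux_cosh (μ : Measure ℝ) (ε : ℝ) :
    ∫⁻ x, ENNReal.ofReal (Real.cosh (ε * x)) ∂μ =
      ∑' n : ℕ, ENNReal.ofReal (ε ^ (2 * n) / (2 * n).factorial) *
        ∫⁻ x, ENNReal.ofReal (x ^ (2 * n)) ∂μ := by
  have hp : ∀ (n : ℕ) (y : ℝ), 0 ≤ y ^ (2 * n) := fun n y => (even_two_mul n).pow_nonneg y
  have : ∀ x : ℝ, ENNReal.ofReal (Real.cosh (ε * x)) =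
      ∑' n : ℕ, ENNReal.ofReal (ε ^ (2 * n) / (2 * n).factorial) * ENNReal.ofReal (x ^ (2 * n)) := by
    intro x
    rw [Real.cosh_eq_tsum, ENNReal.ofReal_tsum_of_nonneg
      (fun n => div_nonneg (hp _ _) (by positivity)) (Real.hasSum_cosh _).summable]
    congr 1
    ext1 n
    rw [← ENNReal.ofReal_mul (div_nonneg (hp _ _) (by positivity))]
    congr 1
    ring
  simp_rw [this]
  rw [lintegral_tsum (fun n => by fun_prop)]
  congr 1
  ext1 n
  rw [lintegral_const_mul _ (by fun_prop)]

theorem non_positive_signed_representation_implies_not_hamburger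
    (s : MeasureTheory.SignedMeasure ℝ) (a : ℕ → ℝ) (ε : ℝ) (hε : 0 < ε)
    (hnotpos : ¬ (0 ≤ s))
    (hdecay : Integrable (fun x : ℝ => Real.exp (ε * |x|)) s.totalVariation)
    (ha : ∀ n : ℕ, a n =
      (∫ x : ℝ, x ^ n ∂s.toJordanDecomposition.posPart) -
        ∫ x : ℝ, x ^ n ∂s.toJordanDecomposition.negPart) :
    ¬ ∃ ν : Measure ℝ,
        (∀ n : ℕ, Integrable (fun x : ℝ => x ^ n) ν) ∧
        ∀ n : ℕ, a n = ∫ x : ℝ, x ^ n ∂ν := by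
  rintro ⟨ν, hint, hν⟩
  apply hnotpos
  have hs := s.toSignedMeasure_toJordanDecomposition
  have hsing := s.toJordanDecomposition.mutuallySingular
  rw [SignedMeasure.totalVariation, integrable_add_measure] at hdecay
  rw [JordanDecomposition.toSignedMeasure] at hs
  generalize s.toJordanDecomposition = J at *
  obtain ⟨p, q, _⟩ := J
  dsimp only at *
  obtain ⟨hp, hq⟩ := hdecay
  have hpow : ∀ (μ : Measure ℝ), Integrable (fun x : ℝ => Real.exp (ε * |x|)) μ →
      ∀ n : ℕ, Integrable (fun x : ℝ => x ^ n) μ := by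
    intro μ hμ n
    have := ProbabilityTheory.integrable_pow_mul_exp_of_mem_interior_integrableExpSet
      (aux_strip_s9 μ ε hμ (t := 0) ⟨by linarith, hε⟩) n
    simpa using this
  have : IsFiniteMeasure ν := by
    have := hint 0
    simp only [pow_zero] at this
    rcases (integrable_const_iff (μ := ν) (c := (1 : ℝ))).1 this with h | h
    · simp at h
    · exact h
  have hev : ∀ (n : ℕ) (y : ℝ), 0 ≤ y ^ (2 * n) := fun n y => (even_two_mul n).pow_nonneg y
  have hle : ∫⁻ x, ENNReal.ofReal (Real.cosh (ε * x)) ∂ν ≤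
      ∫⁻ x, ENNReal.ofReal (Real.cosh (ε * x)) ∂p := by
    rw [aux_cosh, aux_cosh]
    refine ENNReal.tsum_le_tsum fun n => ?_
    refine mul_le_mul_right ?_ _
    rw [← ofReal_integral_eq_lintegral_ofReal (hint _) (Filter.Eventually.of_forall (hev n)),
      ← ofReal_integral_eq_lintegral_ofReal (hpow p hp _) (Filter.Eventually.of_forall (hev n))]
    apply ENNReal.ofReal_le_ofReal
    rw [← hν, ha]
    have : 0 ≤ ∫ x : ℝ, x ^ (2 * n) ∂q := integral_nonneg (hev n)
    linarith
  have hcp : ∫⁻ x, ENNReal.ofReal (Real.cosh (ε * x)) ∂p < ⊤ := by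
    refine lt_of_le_of_lt (lintegral_mono fun x => ?_) hp.lintegral_lt_top
    apply ENNReal.ofReal_le_ofReal
    rw [← Real.cosh_abs, abs_mul, abs_of_pos hε, Real.cosh_eq]
    have : Real.exp (-(ε * |x|)) ≤ Real.exp (ε * |x|) := by
      apply Real.exp_le_exp.2
      have : 0 ≤ ε * |x| := by positivity
      linarith
    linarith
  have hcν : Integrable (fun x : ℝ => Real.cosh (ε * x)) ν := by
    refine ⟨by fun_prop, ?_⟩
    rw [hasFiniteIntegral_iff_ofReal (Filter.Eventually.of_forall fun x => (Real.cosh_pos _).le)]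
    exact hle.trans_lt hcp
  have hνe : Integrable (fun x : ℝ => Real.exp (ε * |x|)) ν := by
    refine (hcν.const_mul 2).mono' (by fun_prop) (Filter.Eventually.of_forall fun x => ?_)
    rw [Real.norm_eq_abs, abs_exp, ← Real.cosh_abs, abs_mul, abs_of_pos hε, Real.cosh_eq]
    have := Real.exp_pos (-(ε * |x|))
    linarith
  have key : p = ν + q := by
    refine aux_unique_s9 p (ν + q) ε hε hp (hνe.add_measure hq) fun n => ?_
    rw [integral_add_measure (hint n) (hpow q hq n), ← hν, ha]
    ring
  have hq0 : q = 0 := by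
    rw [← Measure.MutuallySingular.self_iff]
    refine hsing.mono ?_ le_rfl
    rw [key]
    exact Measure.le_add_left le_rfl
  subst hq0
  rw [← hs, Measure.toSignedMeasure_zero, sub_zero]
  exact Measure.zero_le_toSignedMeasure p
end

section
/- For all n >= 1, E_n = integral over R of y^n * e^{(pi/2)y} / sinh(pi*y) dy; in particular (E_{n+1})_{n>=0} is a Hamburger moment sequence with representing measure having density y * e^{(pi/2)y} / sinh(pi*y). -/
open Real MeasureTheory

lemma aux_exp_integral (c : ℝ) (hc : 0 < c) :
    ∫⁻ y in Set.Ioi (0:ℝ), ENNReal.ofReal (2 * (y * exp (-(c*y)))) =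
      ENNReal.ofReal (2 / c^2) := by
  have h : ∫ y in Set.Ioi (0:ℝ), y * exp (-(c*y)) = 1/c^2 := by
    have := integral_rpow_mul_exp_neg_mul_Ioi (a:=2) (r:=c) (by norm_num) hc
    norm_num at this
    rw [this]; simp
  have hi : IntegrableOn (fun y => y * exp (-(c*y))) (Set.Ioi (0:ℝ)) := by
    by_contra hn
    rw [integral_undef hn] at h
    have : 0 < 1 / c^2 := by positivity
    linarith
  rw [← ofReal_integral_eq_lintegral_ofReal (hi.const_mul 2), integral_const_mul, h]
  · ring_nf
  · filter_upwards [ae_restrict_mem measurableSet_Ioi] with y hy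
    have : (0:ℝ) < y := hy
    simp only [Pi.zero_apply]
    positivity

lemma aux_half (a : ℝ) (ha : a < π) :
    ∫⁻ y in Set.Ioi (0:ℝ), ENNReal.ofReal (y * exp (a * y) / sinh (π * y)) =
      ∑' k : ℕ, ENNReal.ofReal (2 / ((2 * k + 1) * π - a)^2) := by
  have hc : ∀ k : ℕ, 0 < (2 * k + 1) * π - a := by
    intro k
    have : 0 ≤ 2 * (k:ℝ) * π := by positivity
    nlinarith
  simp_rw [← fun k : ℕ => aux_exp_integral _ (hc k)]
  rw [← lintegral_tsum (fun k => by fun_prop)]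
  refine setLIntegral_congr_fun measurableSet_Ioi fun y hy => ?_
  have hy : (0:ℝ) < y := hy
  have hr : exp (-(2 * π * y)) < 1 := by
    rw [Real.exp_lt_one_iff]
    have : 0 < 2 * π * y := by positivity
    linarith
  have hg := hasSum_geometric_of_lt_one (exp_pos (-(2 * π * y))).le hr
  have hs : HasSum (fun k : ℕ => 2 * (y * exp (-(((2 * k + 1) * π - a) * y))))
      (y * exp (a * y) / sinh (π * y)) := by
    have := hg.mul_left (2 * y * exp (a * y) * exp (-(π * y)))
    convert! this using 1
    · funext k
      rw [← Real.exp_nat_mul, mul_assoc, mul_assoc (2 * y), ← Real.exp_add, ← Real.exp_add,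
        mul_assoc]
      ring_nf
    · rw [Real.sinh_eq]
      have e1 : exp (-(2 * π * y)) = exp (-(π * y)) * exp (-(π * y)) := by
        rw [← Real.exp_add]; ring_nf
      have e2 : exp (π * y) * exp (-(π * y)) = 1 := by
        rw [← Real.exp_add]; simp
      have e3 : exp (π * y) - exp (-(π * y)) ≠ 0 := by
        have : exp (-(π * y)) < exp (π * y) := by
          apply Real.exp_lt_exp.2
          have : 0 < π * y := by positivity
          linarith
        linarith
      have e4 : 1 - exp (-(2 * π * y)) ≠ 0 := by linarith
      rw [e1] at e4 ⊢
      generalize exp (π * y) = p at *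
      generalize exp (-(π * y)) = q at *
      generalize exp (a * y) = r at *
      rw [← div_eq_mul_inv, div_eq_div_iff (by intro h; apply e3; linarith) e4]
      linear_combination (-(y * r)) * e2
  show ENNReal.ofReal _ = _
  rw [← hs.tsum_eq, ENNReal.ofReal_tsum_of_nonneg _ hs.summable]
  intro n; positivity

lemma aux_full (a : ℝ) (ha : a < π) (ha' : -π < a) :
    ∫⁻ y : ℝ, ENNReal.ofReal (y * exp (a * y) / sinh (π * y)) =
      ∑' k : ℕ, ENNReal.ofReal (2 / ((2 * k + 1) * π - a)^2) +
      ∑' k : ℕ, ENNReal.ofReal (2 / ((2 * k + 1) * π + a)^2) := by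
  have h2 := aux_half (-a) (by linarith)
  simp only [sub_neg_eq_add] at h2
  rw [← aux_half a ha, ← h2, ← lintegral_add_compl _ (measurableSet_Ioi (a := (0:ℝ)))]
  congr 1
  have := (Measure.measurePreserving_neg (volume : Measure ℝ)).setLIntegral_comp_preimage
    (measurableSet_Iio (a := (0:ℝ)))
    (f := fun y => ENNReal.ofReal (y * exp (a * y) / sinh (π * y))) (by fun_prop)
  rw [Set.compl_Ioi, setLIntegral_congr Iio_ae_eq_Iic.symm, ← this]
  simp only [Set.neg_preimage, Set.neg_Iio, neg_zero]
  refine setLIntegral_congr_fun measurableSet_Ioi fun y hy => ?_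
  simp [Real.sinh_neg, neg_div_neg_eq]

lemma aux_cot (x : ℝ) (hx0 : 0 < x) (hx1 : x < 1) :
    HasSum (fun n : ℕ => 1 / (x - (n + 1)) + 1 / (x + (n + 1)))
      (π * (cos (π * x) / sin (π * x)) - 1 / x) := by
  have hx : (x : ℂ) ∈ Complex.integerComplement := by
    rintro ⟨m, hm⟩
    have hm' : (m : ℝ) = x := by exact_mod_cast hm
    rw [← hm'] at hx0 hx1
    have h1 : 0 < m := by exact_mod_cast hx0
    have h2 : m < 1 := by exact_mod_cast hx1
    omega
  have h := (summable_cotTerm hx).hasSum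
  have h3 := cot_series_rep' hx
  have h4 : HasSum (fun n : ℕ => 1 / ((x:ℂ) - (n + 1)) + 1 / (x + (n + 1)))
      (π * Complex.cot (π * x) - 1 / x) := by
    rw [h3]; exact h
  rw [← Complex.hasSum_ofReal]
  convert h4 using 1
  · funext n; push_cast; rfl
  · simp [Complex.cot]

lemma aux_sq_summable (x : ℝ) : Summable (fun n : ℕ => 1 / ((n:ℝ) + x) ^ 2) := by
  have := (Real.summable_one_div_nat_add_rpow x 2).2 (by norm_num)
  refine this.congr fun n => ?_
  norm_num

lemma aux_csc (x : ℝ) (hx0 : 0 < x) (hx1 : x < 1) :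
    ∑' n : ℕ, 1 / ((n:ℝ) + 1 - x) ^ 2 + ∑' n : ℕ, 1 / ((n:ℝ) + x) ^ 2 =
      π ^ 2 / sin (π * x) ^ 2 := by
  obtain ⟨b, hb0, hb1⟩ := exists_between hx1
  have hb : 0 < 1 - b := by linarith
  have hu : Summable (fun n : ℕ => (1 / (1 - b) ^ 2 + 1) * (1 / ((n:ℝ) + 1) ^ 2)) :=
    (aux_sq_summable 1).mul_left _
  have hmem : x ∈ Set.Ioo 0 b := ⟨hx0, hb0⟩
  have hd := hasDerivAt_tsum_of_isPreconnected (𝕜 := ℝ) (F := ℝ) (t := Set.Ioo 0 b)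
    (g := fun (n : ℕ) x => 1 / (x - (n + 1)) + 1 / (x + (n + 1)))
    (g' := fun (n : ℕ) x => -(1 / ((n:ℝ) + 1 - x) ^ 2 + 1 / ((n:ℝ) + 1 + x) ^ 2))
    (y₀ := x) (y := x)
    hu isOpen_Ioo isPreconnected_Ioo
    (by
      rintro n y ⟨hy0, hyb⟩
      have hn : (0:ℝ) ≤ n := n.cast_nonneg
      have e1 : y - (n + 1) ≠ 0 := by linarith
      have e2 : y + (n + 1) ≠ 0 := by linarith
      have e3 : (n:ℝ) + 1 - y ≠ 0 := by linarith
      have e4 : (n:ℝ) + 1 + y ≠ 0 := by linarith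
      have d1 := ((hasDerivAt_id y).sub_const ((n:ℝ) + 1)).inv e1
      have d2 := ((hasDerivAt_id y).add_const ((n:ℝ) + 1)).inv e2
      have d := d1.add d2
      simp only [one_div]
      refine HasDerivAt.congr_deriv d ?_
      simp only [id]
      rw [show (y - ((n:ℝ) + 1)) ^ 2 = ((n:ℝ) + 1 - y) ^ 2 by ring,
        show (y + ((n:ℝ) + 1)) ^ 2 = ((n:ℝ) + 1 + y) ^ 2 by ring]
      ring)
    (by
      rintro n y ⟨hy0, hyb⟩
      have hn : (0:ℝ) ≤ n := n.cast_nonneg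
      rw [norm_neg, Real.norm_of_nonneg (by positivity), add_mul, one_mul]
      refine add_le_add ?_ ?_
      · rw [div_mul_div_comm, one_mul, ← mul_pow]
        apply one_div_le_one_div_of_le (by positivity)
        apply pow_le_pow_left₀ (by positivity)
        nlinarith
      · apply one_div_le_one_div_of_le (by positivity)
        apply pow_le_pow_left₀ (by positivity)
        linarith)
    hmem (aux_cot x hx0 hx1).summable hmem
  have hsin : sin (π * x) ≠ 0 := by
    apply ne_of_gt
    apply Real.sin_pos_of_pos_of_lt_pi (by positivity)
    nlinarith [Real.pi_pos]
  have hd2 : HasDerivAt (fun z => π * (cos (π * z) / sin (π * z)) - 1 / z)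
      (-(π ^ 2 / sin (π * x) ^ 2) + 1 / x ^ 2) x := by
    have l : HasDerivAt (fun z : ℝ => π * z) π x := by
      simpa using (hasDerivAt_id x).const_mul π
    have d := ((l.cos.div l.sin hsin).const_mul π).sub ((hasDerivAt_id x).inv hx0.ne')
    simp only [one_div]
    refine HasDerivAt.congr_deriv d ?_
    simp only [id]
    have := Real.sin_sq_add_cos_sq (π * x)
    field_simp
    linear_combination (-x^2 * π^2) * this
  have heq : (fun z : ℝ => ∑' n : ℕ, (1 / (z - (n + 1)) + 1 / (z + (n + 1)))) =ᶠ[nhds x]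
      (fun z => π * (cos (π * z) / sin (π * z)) - 1 / z) := by
    filter_upwards [isOpen_Ioo.mem_nhds (show x ∈ Set.Ioo (0:ℝ) 1 from ⟨hx0, hx1⟩)] with z hz
    exact (aux_cot z hz.1 hz.2).tsum_eq
  have key := (hd.congr_of_eventuallyEq heq.symm).unique hd2
  have s1 : Summable (fun n : ℕ => 1 / ((n:ℝ) + 1 - x) ^ 2) :=
    (aux_sq_summable (1 - x)).congr fun n => by ring_nf
  have s2 : Summable (fun n : ℕ => 1 / ((n:ℝ) + 1 + x) ^ 2) :=
    (aux_sq_summable (1 + x)).congr fun n => by ring_nf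
  rw [tsum_neg, s1.tsum_add s2] at key
  rw [(aux_sq_summable x).tsum_eq_zero_add]
  push_cast
  rw [zero_add]
  linarith

lemma aux_mgf (t : ℝ) (ht : |t| < π / 2) :
    ∫⁻ y : ℝ, ENNReal.ofReal (y * exp ((t + π / 2) * y) / sinh (π * y)) =
      ENNReal.ofReal (1 / (1 - sin t)) := by
  rw [abs_lt] at ht
  have hpi := Real.pi_pos
  rw [aux_full _ (by linarith) (by linarith)]
  set x := 3 / 4 + t / (2 * π) with hx
  have hxpi : π * x = 3 * π / 4 + t / 2 := by rw [hx]; field_simp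
  have hx0 : 0 < x := by
    by_contra h
    nlinarith
  have hx1 : x < 1 := by
    by_contra h
    nlinarith
  have e1 : ∀ k : ℕ, 2 / ((2 * k + 1) * π - (t + π / 2)) ^ 2 =
      1 / (2 * π ^ 2) * (1 / ((k:ℝ) + 1 - x) ^ 2) := by
    intro k
    rw [show (2 * k + 1) * π - (t + π / 2) = 2 * π * ((k:ℝ) + 1 - x) by linarith]
    rw [mul_pow, div_mul_div_comm, ← mul_div_mul_left (1 * 1) _ (two_ne_zero (α := ℝ))]
    ring_nf
  have e2 : ∀ k : ℕ, 2 / ((2 * k + 1) * π + (t + π / 2)) ^ 2 =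
      1 / (2 * π ^ 2) * (1 / ((k:ℝ) + x) ^ 2) := by
    intro k
    rw [show (2 * k + 1) * π + (t + π / 2) = 2 * π * ((k:ℝ) + x) by linarith]
    rw [mul_pow, div_mul_div_comm, ← mul_div_mul_left (1 * 1) _ (two_ne_zero (α := ℝ))]
    ring_nf
  have s1 : Summable (fun n : ℕ => 1 / ((n:ℝ) + 1 - x) ^ 2) :=
    (aux_sq_summable (1 - x)).congr fun n => by ring_nf
  simp_rw [e1, e2]
  rw [← ENNReal.ofReal_tsum_of_nonneg (fun n => by positivity) (s1.mul_left _),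
    ← ENNReal.ofReal_tsum_of_nonneg (fun n => by positivity) ((aux_sq_summable x).mul_left _),
    ← ENNReal.ofReal_add (tsum_nonneg fun n => by positivity) (tsum_nonneg fun n => by positivity),
    tsum_mul_left, tsum_mul_left, ← mul_add, aux_csc x hx0 hx1]
  congr 1
  have h1 : 1 - sin t = 2 * sin (π * x) ^ 2 := by
    have h := Real.cos_two_mul (π * x)
    have h' := Real.sin_sq_add_cos_sq (π * x)
    have h'' : cos (2 * (π * x)) = sin t := by
      rw [hxpi, show 2 * (3 * π / 4 + t / 2) = t + π / 2 + π by ring, Real.cos_add_pi,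
        Real.cos_add_pi_div_two, neg_neg]
    linarith
  rw [h1]
  field_simp

lemma aux_dens_nonneg (y : ℝ) : 0 ≤ y * exp (π / 2 * y) / sinh (π * y) := by
  have hpi := Real.pi_pos
  rcases le_total 0 y with h | h
  · have : 0 ≤ sinh (π * y) := Real.sinh_nonneg_iff.2 (by positivity)
    positivity
  · have : sinh (π * y) ≤ 0 := Real.sinh_nonpos_iff.2 (mul_nonpos_of_nonneg_of_nonpos hpi.le h)
    exact div_nonneg_of_nonpos (mul_nonpos_of_nonpos_of_nonneg h (exp_pos _).le) this

lemma aux_coeff (f : ℝ → ℝ) (c : ℕ → ℝ)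
    (h : HasFPowerSeriesAt f (FormalMultilinearSeries.ofScalars ℝ c) 0) (n : ℕ) :
    iteratedDeriv n f 0 = n.factorial * c n := by
  have h2 := h.analyticAt.hasFPowerSeriesAt
  have := h.eq_formalMultilinearSeries h2
  rw [FormalMultilinearSeries.ofScalars_series_eq_iff] at this
  rw [this]; field_simp

lemma aux_E (E : ℕ → ℝ)
    (hE : ∀ t : ℝ, |t| < π / 2 →
      HasSum (fun n : ℕ => E n * t ^ n / (n.factorial : ℝ))
        (1 / Real.cos t + Real.tan t)) (n : ℕ) :
    E (n + 1) = iteratedDeriv n (fun t => 1 / (1 - sin t)) 0 := by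
  have hpi := Real.pi_pos
  have hnear : ∀ᶠ t in nhds (0:ℝ), |t| < π / 2 :=
    (continuous_abs.tendsto' (0:ℝ) 0 (by simp)).eventually (gt_mem_nhds (by positivity))
  have h : HasFPowerSeriesAt (fun t => 1 / cos t + tan t)
      (FormalMultilinearSeries.ofScalars ℝ (fun n => E n / n.factorial)) 0 := by
    rw [hasFPowerSeriesAt_iff]
    filter_upwards [hnear] with t ht
    convert! hE t ht using 1
    · funext n
      simp [FormalMultilinearSeries.coeff_ofScalars]
      ring
    · simp
  have h2 := aux_coeff _ _ h (n + 1)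
  rw [mul_div_cancel₀ _ (by positivity)] at h2
  rw [← h2, iteratedDeriv_succ']
  apply Filter.EventuallyEq.iteratedDeriv_eq
  filter_upwards [hnear] with t ht
  rw [abs_lt] at ht
  have hc : cos t ≠ 0 := (Real.cos_pos_of_mem_Ioo ⟨ht.1, ht.2⟩).ne'
  have hsq := Real.sin_sq_add_cos_sq t
  have hs : 1 - sin t ≠ 0 := by
    intro h0
    apply hc
    have : cos t ^ 2 = 0 := by
      have : sin t = 1 := by linarith
      rw [this] at hsq; linarith
    simpa using this
  have d := ((Real.hasDerivAt_cos t).inv hc).add (Real.hasDerivAt_tan hc)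
  simp only [one_div] at d ⊢
  refine d.deriv.trans ?_
  field_simp
  linear_combination (-1) * hsq

theorem euler_numbers_integral_representation (E : ℕ → ℝ)
    (hE : ∀ t : ℝ, |t| < π / 2 →
      HasSum (fun n : ℕ => E n * t ^ n / (n.factorial : ℝ))
        (1 / Real.cos t + Real.tan t)) :
    (∀ n : ℕ, 1 ≤ n →
      E n = ∫ y : ℝ, y ^ n * Real.exp (π / 2 * y) / Real.sinh (π * y)) ∧
    ∃ μ : Measure ℝ,
      μ = MeasureTheory.volume.withDensity
            (fun y : ℝ => ENNReal.ofReal (y * Real.exp (π / 2 * y) / Real.sinh (π * y))) ∧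
      ∀ n : ℕ, Integrable (fun x : ℝ => x ^ n) μ ∧ E (n + 1) = ∫ x : ℝ, x ^ n ∂μ := by
  have hpi := Real.pi_pos
  have hmeas : Measurable (fun y : ℝ => ENNReal.ofReal
      (y * Real.exp (π / 2 * y) / Real.sinh (π * y))) := by fun_prop
  obtain ⟨μ, hμ⟩ : ∃ μ : Measure ℝ, μ = MeasureTheory.volume.withDensity
            (fun y : ℝ => ENNReal.ofReal (y * Real.exp (π / 2 * y) / Real.sinh (π * y))) := ⟨_, rfl⟩
  have hl : ∀ t : ℝ, |t| < π / 2 →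
      ∫⁻ y, ENNReal.ofReal (exp (t * y)) ∂μ = ENNReal.ofReal (1 / (1 - sin t)) := by
    intro t ht
    rw [← aux_mgf t ht, hμ, lintegral_withDensity_eq_lintegral_mul _ hmeas (by fun_prop)]
    refine lintegral_congr fun y => ?_
    rw [Pi.mul_apply, ← ENNReal.ofReal_mul (aux_dens_nonneg y)]
    congr 1
    rw [add_mul, Real.exp_add]
    ring
  have hint : ∀ t : ℝ, |t| < π / 2 → t ∈ ProbabilityTheory.integrableExpSet id μ := by
    intro t ht
    show Integrable (fun y => exp (t * y)) μ
    refine ⟨by fun_prop, ?_⟩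
    rw [hasFiniteIntegral_iff_ofReal (ae_of_all _ fun y => (exp_pos _).le), hl t ht]
    exact ENNReal.ofReal_lt_top
  have hnear : ∀ᶠ t in nhds (0:ℝ), |t| < π / 2 :=
    (continuous_abs.tendsto' (0:ℝ) 0 (by simp)).eventually (gt_mem_nhds (by positivity))
  have h0 : (0:ℝ) ∈ interior (ProbabilityTheory.integrableExpSet id μ) := by
    rw [mem_interior_iff_mem_nhds]
    filter_upwards [hnear] with t ht using hint t ht
  have hmgf : ProbabilityTheory.mgf id μ =ᶠ[nhds 0] fun t => 1 / (1 - sin t) := by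
    filter_upwards [hnear] with t ht
    rw [ProbabilityTheory.mgf]
    simp only [id]
    rw [integral_eq_lintegral_of_nonneg_ae (ae_of_all _ fun y => (exp_pos _).le) (by fun_prop),
      hl t ht, ENNReal.toReal_ofReal]
    exact one_div_nonneg.2 (by linarith [Real.sin_le_one t])
  have hmom : ∀ n : ℕ, E (n + 1) = ∫ x : ℝ, x ^ n ∂μ := by
    intro n
    rw [aux_E E hE n, ← hmgf.iteratedDeriv_eq n, ProbabilityTheory.iteratedDeriv_mgf_zero h0 n]
    simp
  refine ⟨?_, μ, hμ, fun n => ⟨?_, hmom n⟩⟩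
  · intro n hn
    obtain ⟨m, rfl⟩ : ∃ m, n = m + 1 := ⟨n - 1, by omega⟩
    rw [hmom m, hμ, integral_withDensity_eq_integral_toReal_smul hmeas
      (ae_of_all _ fun y => ENNReal.ofReal_lt_top)]
    refine integral_congr_ae (ae_of_all _ fun y => ?_)
    simp only [smul_eq_mul]
    rw [ENNReal.toReal_ofReal (aux_dens_nonneg y)]
    ring
  · exact ProbabilityTheory.integrable_pow_of_mem_interior_integrableExpSet h0 n
end

section
/- For all n >= 0, the secant number E_{2n} equals the integral over [0,infinity) of y^{2n} * sech((pi/2)*y) dy, and the tangent number E_{2n+1} equals the integral over [0,infinity) of y^{2n+1} * csch((pi/2)*y) dy; consequently (E_{2n})_{n>=0} and (E_{2n+1})_{n>=0} are Stieltjes moment sequences. -/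
open Real MeasureTheory

noncomputable def sechDens (y : ℝ) : ENNReal := ENNReal.ofReal (1 / (2 * Real.cosh (π / 2 * y)))

noncomputable def sechMeas : Measure ℝ := volume.withDensity sechDens

lemma measurable_sechDens : Measurable sechDens := by
  unfold sechDens
  refine ENNReal.measurable_ofReal.comp (Continuous.measurable ?_)
  refine Continuous.div (by fun_prop) (by fun_prop) fun y => ?_
  have := Real.cosh_pos (π / 2 * y)
  positivity

lemma sig_eq (y : ℝ) : sigmoid (π * y) = exp (π / 2 * y) / (2 * cosh (π / 2 * y)) := by
  rw [sigmoid_def, Real.cosh_eq, inv_eq_one_div, div_eq_div_iff (by positivity) (by positivity)]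
  rw [mul_add, ← Real.exp_add, show π / 2 * y + -(π * y) = -(π / 2 * y) by ring]
  ring

lemma one_sub_sig_eq (y : ℝ) :
    1 - sigmoid (π * y) = exp (-(π / 2 * y)) / (2 * cosh (π / 2 * y)) := by
  have := sig_eq (-y)
  rw [mul_neg, mul_neg, Real.cosh_neg, sigmoid_neg] at this
  exact this

lemma lintegral_sech (t : ℝ) (ht : |t| < π / 2) :
    ∫⁻ y, ENNReal.ofReal (exp (t * y)) ∂sechMeas = ENNReal.ofReal (1 / cos t) := by
  have hpi := Real.pi_pos
  obtain ⟨h1, h2⟩ := abs_lt.1 ht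
  have hc : 0 < cos t := Real.cos_pos_of_mem_Ioo ⟨h1, h2⟩
  set α : ℝ := 1 / 2 + t / π with hαd
  set β : ℝ := 1 / 2 - t / π with hβd
  have hα : 0 < α := by
    have : -(1/2) < t / π := by rw [lt_div_iff₀ hpi]; linarith
    linarith
  have hβ : 0 < β := by
    have : t / π < 1/2 := by rw [div_lt_iff₀ hpi]; linarith
    linarith
  have hb : ProbabilityTheory.beta α β = π / cos t := by
    rw [ProbabilityTheory.beta, show α + β = 1 by rw [hαd, hβd]; ring,
      show β = 1 - α by rw [hαd, hβd]; ring, Real.Gamma_mul_Gamma_one_sub, Real.Gamma_one, div_one,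
      show π * α = t + π / 2 by rw [hαd]; field_simp; ring, Real.sin_add_pi_div_two]
  have key := ProbabilityTheory.lintegral_betaPDF_eq_one hα hβ
  have himg : (fun y : ℝ => sigmoid (π * y)) '' Set.univ = Set.Ioo 0 1 := by
    rw [Set.image_univ, ← range_sigmoid]
    have : (fun y : ℝ => sigmoid (π * y)) = sigmoid ∘ (fun y => π * y) := rfl
    rw [this, Function.Surjective.range_comp]
    intro y; exact ⟨y / π, by field_simp⟩
  have hder : ∀ y ∈ (Set.univ : Set ℝ), HasDerivWithinAt (fun y : ℝ => sigmoid (π * y))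
      (sigmoid (π * y) * (1 - sigmoid (π * y)) * (π * 1)) Set.univ y := by
    intro y _
    exact ((hasDerivAt_sigmoid (π * y)).comp y ((hasDerivAt_id y).const_mul π)).hasDerivWithinAt
  have hinj : Set.InjOn (fun y : ℝ => sigmoid (π * y)) Set.univ := by
    intro a _ b _ h
    exact mul_left_cancel₀ hpi.ne' (sigmoid_injective h)
  rw [ProbabilityTheory.lintegral_betaPDF, ← himg,
    lintegral_image_eq_lintegral_abs_deriv_mul MeasurableSet.univ hder hinj,
    Measure.restrict_univ] at key
  have hpt : ∀ y : ℝ, ENNReal.ofReal |sigmoid (π * y) * (1 - sigmoid (π * y)) * (π * 1)| *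
      ENNReal.ofReal (1 / ProbabilityTheory.beta α β * sigmoid (π * y) ^ (α - 1) *
        (1 - sigmoid (π * y)) ^ (β - 1)) =
      ENNReal.ofReal (cos t) * (sechDens y * ENNReal.ofReal (exp (t * y))) := by
    intro y
    have hC := Real.cosh_pos (π / 2 * y)
    have hs : 0 < sigmoid (π * y) := sigmoid_pos _
    have hs1 : 0 < 1 - sigmoid (π * y) := by have := sigmoid_lt_one (π * y); linarith
    rw [abs_of_pos (by positivity), ← ENNReal.ofReal_mul (by positivity), sechDens,
      ← ENNReal.ofReal_mul (by positivity), ← ENNReal.ofReal_mul (by positivity)]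
    congr 1
    rw [hb, Real.rpow_sub_one hs.ne', Real.rpow_sub_one hs1.ne']
    have : sigmoid (π * y) ^ α * (1 - sigmoid (π * y)) ^ β =
        1 / (2 * cosh (π / 2 * y)) * exp (t * y) := by
      rw [one_sub_sig_eq, sig_eq, Real.div_rpow (by positivity) (by positivity),
        Real.div_rpow (by positivity) (by positivity), div_mul_div_comm,
        ← Real.rpow_add (by positivity), show α + β = 1 by rw [hαd, hβd]; ring, Real.rpow_one,
        ← Real.exp_mul, ← Real.exp_mul, ← Real.exp_add,
        show π / 2 * y * α + -(π / 2 * y) * β = t * y by rw [hαd, hβd]; field_simp; ring]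
      ring
    rw [← this]
    field_simp
  simp_rw [hpt] at key
  have hm : Measurable fun x => sechDens x * ENNReal.ofReal (exp (t * x)) :=
    measurable_sechDens.mul (by fun_prop)
  rw [lintegral_const_mul _ hm] at key
  rw [sechMeas, lintegral_withDensity_eq_lintegral_mul _ measurable_sechDens (by fun_prop)]
  simp only [Pi.mul_apply]
  rw [one_div, ENNReal.ofReal_inv_of_pos hc]
  exact ENNReal.eq_inv_of_mul_eq_one_left (by rw [mul_comm]; exact key)

open Filter Topology

lemma tendsto_logcosh_atTop (y : ℝ) :
    Tendsto (fun a : ℝ => log (cosh (π / 2 * a)) - log (cosh (π / 2 * (-a + y)))) atTop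
      (𝓝 (π / 2 * y)) := by
  have hpi := Real.pi_pos
  have h0 : Tendsto (fun a : ℝ => exp (-(π * a))) atTop (𝓝 0) :=
    Real.tendsto_exp_neg_atTop_nhds_zero.comp (tendsto_id.const_mul_atTop hpi)
  have h1 : Tendsto (fun a : ℝ => (1 + exp (-(π * a))) /
      (exp (π / 2 * y) * exp (-(π * a)) + exp (-(π / 2 * y)))) atTop
      (𝓝 ((1 + 0) / (exp (π / 2 * y) * 0 + exp (-(π / 2 * y))))) :=
    (h0.const_add 1).div ((h0.const_mul _).add_const _) (by simp [exp_ne_zero])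
  have h2 := h1.log (by simp [exp_ne_zero])
  have e : log ((1 + 0) / (exp (π / 2 * y) * 0 + exp (-(π / 2 * y)))) = π / 2 * y := by
    simp
  rw [e] at h2
  refine h2.congr fun a => ?_
  rw [← Real.log_div (Real.cosh_pos _).ne' (Real.cosh_pos _).ne']
  congr 1
  rw [Real.cosh_eq, Real.cosh_eq, div_div_div_cancel_right₀ two_ne_zero,
    div_eq_div_iff (by positivity) (by positivity)]
  simp only [add_mul, mul_add, ← Real.exp_add, one_mul]
  ring_nf

lemma tendsto_logcosh_atBot (y : ℝ) :
    Tendsto (fun a : ℝ => log (cosh (π / 2 * a)) - log (cosh (π / 2 * (-a + y)))) atBot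
      (𝓝 (-(π / 2 * y))) := by
  have h := (tendsto_logcosh_atTop (-y)).comp tendsto_neg_atBot_atTop
  rw [mul_neg] at h
  refine h.congr fun a => ?_
  simp only [Function.comp]
  rw [mul_neg, Real.cosh_neg, ← Real.cosh_neg (π / 2 * (- -a + -y))]
  ring_nf

lemma integrable_sech : Integrable (fun y : ℝ => 1 / (2 * cosh (π / 2 * y))) := by
  have hc : Continuous fun y : ℝ => 1 / (2 * cosh (π / 2 * y)) := by
    refine Continuous.div (by fun_prop) (by fun_prop) fun y => ?_
    have := Real.cosh_pos (π / 2 * y)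
    positivity
  refine ⟨hc.aestronglyMeasurable, ?_⟩
  rw [hasFiniteIntegral_iff_ofReal (Eventually.of_forall fun y => by
    have := Real.cosh_pos (π / 2 * y)
    positivity)]
  have h := lintegral_sech 0 (by simp [Real.pi_pos])
  rw [sechMeas, lintegral_withDensity_eq_lintegral_mul _ measurable_sechDens (by fun_prop)] at h
  simp only [Pi.mul_apply, zero_mul, exp_zero, ENNReal.ofReal_one, mul_one] at h
  change ∫⁻ y, sechDens y < _
  rw [h]; exact ENNReal.ofReal_lt_top

lemma conv_sech (y : ℝ) (hy : y ≠ 0) :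
    ∫⁻ a, sechDens a * sechDens (-a + y) = ENNReal.ofReal (y / (2 * sinh (π / 2 * y))) := by
  have hpi := Real.pi_pos
  have hcont : ∀ z : ℝ, Continuous fun a : ℝ => 1 / (2 * cosh (π / 2 * (-a + z))) := by
    intro z
    refine Continuous.div (by fun_prop) (by fun_prop) fun y => ?_
    have := Real.cosh_pos (π / 2 * (-y + z))
    positivity
  have hS : sinh (π / 2 * y) ≠ 0 := by
    rw [Ne, Real.sinh_eq_zero]; positivity
  have hint : Integrable (fun a : ℝ => 1 / (2 * cosh (π / 2 * a)) *
      (1 / (2 * cosh (π / 2 * (-a + y))))) := by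
    refine integrable_sech.mono (integrable_sech.aestronglyMeasurable.mul
      (hcont y).aestronglyMeasurable) (Eventually.of_forall fun a => ?_)
    rw [norm_mul]
    refine mul_le_of_le_one_right (norm_nonneg _) ?_
    have := Real.one_le_cosh (π / 2 * (-a + y))
    rw [Real.norm_of_nonneg (by positivity), div_le_one (by positivity)]
    linarith
  have hder : ∀ a : ℝ, HasDerivAt (fun a : ℝ =>
      (log (cosh (π / 2 * a)) - log (cosh (π / 2 * (-a + y)))) / (2 * π * sinh (π / 2 * y)))
      (1 / (2 * cosh (π / 2 * a)) * (1 / (2 * cosh (π / 2 * (-a + y))))) a := by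
    intro a
    have hA := Real.cosh_pos (π / 2 * a)
    have hB := Real.cosh_pos (π / 2 * (-a + y))
    have d1 : HasDerivAt (fun a : ℝ => π / 2 * a) (π / 2 * 1) a := (hasDerivAt_id a).const_mul _
    have d2 : HasDerivAt (fun a : ℝ => π / 2 * (-a + y)) (π / 2 * -1) a :=
      ((hasDerivAt_id a).neg.add_const y).const_mul _
    have d := ((d1.cosh.log hA.ne').sub (d2.cosh.log hB.ne')).div_const
      (2 * π * sinh (π / 2 * y))
    refine d.congr_deriv ?_
    have e : sinh (π / 2 * y) = sinh (π / 2 * a) * cosh (π / 2 * (-a + y)) +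
        cosh (π / 2 * a) * sinh (π / 2 * (-a + y)) := by
      rw [← Real.sinh_add]; congr 1; ring
    rw [div_eq_iff (by positivity), div_sub_div _ _ hA.ne' hB.ne', div_eq_iff (by positivity), e]
    field_simp
    ring
  have hI := integral_of_hasDerivAt_of_tendsto hder hint
    ((tendsto_logcosh_atBot y).div_const _) ((tendsto_logcosh_atTop y).div_const _)
  have : ∀ a, sechDens a * sechDens (-a + y) = ENNReal.ofReal (1 / (2 * cosh (π / 2 * a)) *
      (1 / (2 * cosh (π / 2 * (-a + y))))) := by
    intro a
    have hA := Real.cosh_pos (π / 2 * a)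
    rw [ENNReal.ofReal_mul (by positivity)]; rfl
  simp_rw [this]
  rw [← ofReal_integral_eq_lintegral_ofReal hint, hI]
  · congr 1; field_simp; ring
  · refine Eventually.of_forall fun a => ?_
    have hA := Real.cosh_pos (π / 2 * a)
    have hB := Real.cosh_pos (π / 2 * (-a + y))
    positivity

noncomputable def cschDens (y : ℝ) : ENNReal := ENNReal.ofReal (y / (2 * Real.sinh (π / 2 * y)))

noncomputable def cschMeas : Measure ℝ := volume.withDensity cschDens

lemma measurable_cschDens : Measurable cschDens := by
  unfold cschDens
  refine ENNReal.measurable_ofReal.comp (measurable_id.div (Continuous.measurable ?_))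
  fun_prop

lemma cschMeas_eq : cschMeas = sechMeas ∗ sechMeas := by
  rw [sechMeas, conv_withDensity_eq_lconvolution measurable_sechDens measurable_sechDens, cschMeas]
  refine withDensity_congr_ae ?_
  filter_upwards [Measure.ae_ne volume (0 : ℝ)] with y hy
  rw [lconvolution_def, conv_sech y hy, cschDens]

instance : SFinite sechMeas := by unfold sechMeas; infer_instance

lemma lintegral_csch (t : ℝ) (ht : |t| < π / 2) :
    ∫⁻ y, ENNReal.ofReal (exp (t * y)) ∂cschMeas = ENNReal.ofReal (1 / cos t ^ 2) := by
  obtain ⟨h1, h2⟩ := abs_lt.1 ht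
  have hc : 0 < cos t := Real.cos_pos_of_mem_Ioo ⟨h1, h2⟩
  rw [cschMeas_eq, Measure.lintegral_conv (by fun_prop)]
  simp_rw [mul_add, Real.exp_add, ENNReal.ofReal_mul (exp_pos _).le]
  have : ∀ x : ℝ, ∫⁻ y, ENNReal.ofReal (exp (t * x)) * ENNReal.ofReal (exp (t * y)) ∂sechMeas =
      ENNReal.ofReal (exp (t * x)) * ENNReal.ofReal (1 / cos t) := by
    intro x
    rw [lintegral_const_mul _ (by fun_prop), lintegral_sech t ht]
  simp_rw [this]
  rw [lintegral_mul_const _ (by fun_prop), lintegral_sech t ht, ← ENNReal.ofReal_mul (by positivity)]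
  congr 1; field_simp

open ProbabilityTheory

lemma mgf_facts {m : Measure ℝ} {g : ℝ → ℝ} (hg : ∀ t, |t| < π / 2 → 0 ≤ g t)
    (h : ∀ t, |t| < π / 2 → ∫⁻ y, ENNReal.ofReal (exp (t * y)) ∂m = ENNReal.ofReal (g t)) :
    0 ∈ interior (integrableExpSet id m) ∧ mgf id m =ᶠ[𝓝 0] g := by
  have hn : {t : ℝ | |t| < π / 2} ∈ 𝓝 (0 : ℝ) :=
    (isOpen_lt continuous_abs continuous_const).mem_nhds (by simp [Real.pi_pos])
  constructor
  · rw [mem_interior_iff_mem_nhds]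
    filter_upwards [hn] with t ht
    rw [integrableExpSet, Set.mem_ofPred_eq]
    refine ⟨by simp only [id]; fun_prop, ?_⟩
    rw [hasFiniteIntegral_iff_ofReal (Eventually.of_forall fun y => (exp_pos _).le)]
    simp only [id]
    rw [h t ht]; exact ENNReal.ofReal_lt_top
  · filter_upwards [hn] with t ht
    rw [mgf, integral_eq_lintegral_of_nonneg_ae (Eventually.of_forall fun y => (exp_pos _).le)
      (by simp only [id]; fun_prop)]
    simp only [id]
    rw [h t ht, ENNReal.toReal_ofReal (hg t ht)]

lemma cos_pos' {t : ℝ} (ht : |t| < π / 2) : 0 < cos t :=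
  Real.cos_pos_of_mem_Ioo (abs_lt.1 ht)

lemma sech_facts : 0 ∈ interior (integrableExpSet id sechMeas) ∧
    mgf id sechMeas =ᶠ[𝓝 0] fun t => 1 / cos t :=
  mgf_facts (fun t ht => (one_div_pos.2 (cos_pos' ht)).le) lintegral_sech

lemma csch_facts : 0 ∈ interior (integrableExpSet id cschMeas) ∧
    mgf id cschMeas =ᶠ[𝓝 0] fun t => 1 / cos t ^ 2 :=
  mgf_facts (fun t ht => by have := cos_pos' ht; positivity) lintegral_csch

lemma integral_sechMeas (n : ℕ) :
    ∫ y, y ^ n ∂sechMeas = ∫ y : ℝ, y ^ n * (1 / (2 * cosh (π / 2 * y))) := by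
  rw [sechMeas, integral_withDensity_eq_integral_toReal_smul measurable_sechDens
    (Eventually.of_forall fun y => ENNReal.ofReal_lt_top)]
  refine integral_congr_ae (Eventually.of_forall fun y => ?_)
  have := Real.cosh_pos (π / 2 * y)
  simp only [sechDens, smul_eq_mul]
  rw [ENNReal.toReal_ofReal (by positivity), mul_comm]

lemma div_sinh_nonneg (y : ℝ) : 0 ≤ y / (2 * sinh (π / 2 * y)) := by
  have hpi := Real.pi_pos
  rcases le_total 0 y with h | h
  · exact div_nonneg h (mul_nonneg zero_le_two (Real.sinh_nonneg_iff.2 (by positivity)))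
  · exact div_nonneg_of_nonpos h (mul_nonpos_of_nonneg_of_nonpos zero_le_two
      (Real.sinh_nonpos_iff.2 (mul_nonpos_of_nonneg_of_nonpos (by positivity) h)))

lemma integral_cschMeas (n : ℕ) :
    ∫ y, y ^ n ∂cschMeas = ∫ y : ℝ, y ^ n * (y / (2 * sinh (π / 2 * y))) := by
  rw [cschMeas, integral_withDensity_eq_integral_toReal_smul measurable_cschDens
    (Eventually.of_forall fun y => ENNReal.ofReal_lt_top)]
  refine integral_congr_ae (Eventually.of_forall fun y => ?_)
  simp only [cschDens, smul_eq_mul]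
  rw [ENNReal.toReal_ofReal (div_sinh_nonneg y), mul_comm]

lemma integral_odd {f : ℝ → ℝ} (hf : ∀ y, f (-y) = -f y) : ∫ y, f y = 0 := by
  have h := integral_neg_eq_self f volume
  simp_rw [hf, integral_neg] at h
  linarith

lemma sech_odd (n : ℕ) : ∫ y, y ^ (2 * n + 1) ∂sechMeas = 0 := by
  rw [integral_sechMeas]
  refine integral_odd fun y => ?_
  rw [mul_neg, Real.cosh_neg, Odd.neg_pow ⟨n, rfl⟩]; ring

lemma csch_odd (n : ℕ) : ∫ y, y ^ (2 * n + 1) ∂cschMeas = 0 := by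
  rw [integral_cschMeas]
  refine integral_odd fun y => ?_
  rw [mul_neg, Real.sinh_neg, Odd.neg_pow ⟨n, rfl⟩, mul_neg, neg_div_neg_eq]; ring

lemma sech_even (n : ℕ) : ∫ y, y ^ (2 * n) ∂sechMeas =
    ∫ y in Set.Ioi (0 : ℝ), y ^ (2 * n) * (1 / cosh (π / 2 * y)) := by
  rw [integral_sechMeas]
  have h := integral_comp_abs (f := fun y => y ^ (2 * n) * (1 / (2 * cosh (π / 2 * y))))
  rw [← integral_const_mul] at h
  convert! h using 2
  · ext y
    rcases abs_choice y with h | h <;> rw [h]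
    rw [mul_neg, Real.cosh_neg, Even.neg_pow ⟨n, by ring⟩]
  · ext y
    have := Real.cosh_pos (π / 2 * y)
    field_simp

lemma csch_even (n : ℕ) : ∫ y, y ^ (2 * n) ∂cschMeas =
    ∫ y in Set.Ioi (0 : ℝ), y ^ (2 * n + 1) * (1 / sinh (π / 2 * y)) := by
  rw [integral_cschMeas]
  have h := integral_comp_abs (f := fun y => y ^ (2 * n) * (y / (2 * sinh (π / 2 * y))))
  rw [← integral_const_mul] at h
  convert! h using 2
  · ext y
    rcases abs_choice y with h | h <;> rw [h]
    rw [mul_neg, Real.sinh_neg, Even.neg_pow ⟨n, by ring⟩, mul_neg, neg_div_neg_eq]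
  · ext y
    by_cases hy : sinh (π / 2 * y) = 0
    · simp [hy]
    · rw [pow_succ]; field_simp

lemma iteratedDeriv_E (E : ℕ → ℝ) (f : ℝ → ℝ)
    (hE : ∀ t : ℝ, |t| < π / 2 → HasSum (fun n : ℕ => E n * t ^ n / (n.factorial : ℝ)) (f t))
    (n : ℕ) : E n = iteratedDeriv n f 0 := by
  have hp : HasFPowerSeriesOnBall f
      (FormalMultilinearSeries.ofScalars ℝ (fun n => E n / (n.factorial : ℝ))) 0 1 := by
    have h3 : (1 : ℝ) < π / 2 := by have := Real.pi_gt_three; linarith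
    refine ⟨?_, by simp, ?_⟩
    · have := (hE 1 (by simpa using h3)).summable.norm
      rw [← ENNReal.coe_one]
      refine FormalMultilinearSeries.le_radius_of_summable _ (this.congr fun n => ?_)
      simp
    · intro y hy
      have hy' : |y| < 1 := by
        rw [← ENNReal.ofReal_one, Metric.eball_ofReal] at hy
        simpa using hy
      rw [zero_add]
      convert! hE y (hy'.trans h3) using 2 with k
      simp [FormalMultilinearSeries.ofScalars, mul_div_right_comm]
  have hA : AnalyticAt ℝ f 0 := ⟨_, hp.hasFPowerSeriesAt⟩
  have := congrArg (fun q => FormalMultilinearSeries.coeff q n)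
    (hp.hasFPowerSeriesAt.eq_formalMultilinearSeries hA.hasFPowerSeriesAt)
  simp only [FormalMultilinearSeries.coeff_ofScalars] at this
  exact (div_left_inj' (by positivity)).1 this

theorem secant_tangent_numbers_integral_representation (E : ℕ → ℝ)
    (hE : ∀ t : ℝ, |t| < π / 2 →
      HasSum (fun n : ℕ => E n * t ^ n / (n.factorial : ℝ))
        (1 / Real.cos t + Real.tan t)) :
    (∀ n : ℕ,
        E (2 * n) = ∫ y in Set.Ioi (0 : ℝ), y ^ (2 * n) * (1 / Real.cosh (π / 2 * y)) ∧
        E (2 * n + 1) = ∫ y in Set.Ioi (0 : ℝ), y ^ (2 * n + 1) * (1 / Real.sinh (π / 2 * y))) ∧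
    (∃ μ : Measure ℝ, μ {x : ℝ | x < 0} = 0 ∧
      ∀ n : ℕ, Integrable (fun x : ℝ => x ^ n) μ ∧ E (2 * n) = ∫ x : ℝ, x ^ n ∂μ) ∧
    (∃ μ : Measure ℝ, μ {x : ℝ | x < 0} = 0 ∧
      ∀ n : ℕ, Integrable (fun x : ℝ => x ^ n) μ ∧ E (2 * n + 1) = ∫ x : ℝ, x ^ n ∂μ) := by
  have hsec := sech_facts
  have hcsc := csch_facts
  have aS : AnalyticAt ℝ (fun t : ℝ => 1 / cos t) 0 :=
    (analyticAt_mgf hsec.1).congr hsec.2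
  have hcos : ∀ᶠ t : ℝ in 𝓝 0, cos t ≠ 0 :=
    Real.continuous_cos.continuousAt.eventually_ne (by simp)
  have aT : AnalyticAt ℝ Real.tan 0 := by
    have : AnalyticAt ℝ (fun t : ℝ => sin t / cos t) 0 :=
      Real.analyticAt_sin.div Real.analyticAt_cos (by simp)
    exact this.congr (Eventually.of_forall fun t => (Real.tan_eq_sin_div_cos t).symm)
  have dS : ∀ n, iteratedDeriv n (fun t : ℝ => 1 / cos t) 0 = ∫ y, y ^ n ∂sechMeas := by
    intro n
    rw [← hsec.2.iteratedDeriv_eq n, iteratedDeriv_mgf_zero hsec.1]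
    rfl
  have dT : ∀ n, iteratedDeriv (n + 1) Real.tan 0 = ∫ y, y ^ n ∂cschMeas := by
    intro n
    have hd : deriv Real.tan =ᶠ[𝓝 0] fun t => 1 / cos t ^ 2 := by
      filter_upwards [hcos] with t ht
      rw [Real.deriv_tan]
    rw [iteratedDeriv_succ', (hd.trans hcsc.2.symm).iteratedDeriv_eq n,
      iteratedDeriv_mgf_zero hcsc.1]
    rfl
  have hsum : ∀ n, E n = iteratedDeriv n (fun t : ℝ => 1 / cos t) 0 +
      iteratedDeriv n Real.tan 0 := by
    intro n
    rw [iteratedDeriv_E E _ hE n]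
    exact iteratedDeriv_fun_add aS.contDiffAt aT.contDiffAt
  have hEven : ∀ n, E (2 * n) = ∫ y, y ^ (2 * n) ∂sechMeas := by
    intro n
    rw [hsum, dS]
    cases n with
    | zero => simp
    | succ k =>
      rw [show 2 * (k + 1) = (2 * k + 1) + 1 by ring, dT, csch_odd, add_zero]
  have hOdd : ∀ n, E (2 * n + 1) = ∫ y, y ^ (2 * n) ∂cschMeas := by
    intro n
    rw [hsum, dS, dT, sech_odd, zero_add]
  have hsq : Measurable fun y : ℝ => y ^ 2 := by fun_prop
  have hmap : ∀ m : Measure ℝ, 0 ∈ interior (integrableExpSet id m) →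
      (m.map fun y => y ^ 2) {x : ℝ | x < 0} = 0 ∧ ∀ n : ℕ,
        Integrable (fun x : ℝ => x ^ n) (m.map fun y => y ^ 2) ∧
        ∫ y, y ^ (2 * n) ∂m = ∫ x : ℝ, x ^ n ∂(m.map fun y => y ^ 2) := by
    intro m hm
    refine ⟨?_, fun n => ⟨?_, ?_⟩⟩
    · have hms : MeasurableSet {x : ℝ | x < 0} := measurableSet_lt measurable_id measurable_const
      rw [Measure.map_apply hsq hms]
      convert! measure_empty (μ := m)
      ext y
      simp [sq_nonneg]
    · rw [integrable_map_measure (by fun_prop) hsq.aemeasurable]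
      refine (integrable_pow_of_mem_interior_integrableExpSet hm (2 * n)).congr
        (Eventually.of_forall fun y => ?_)
      simp [pow_mul]
    · rw [integral_map hsq.aemeasurable (by fun_prop)]
      simp [pow_mul]
  refine ⟨fun n => ⟨(hEven n).trans (sech_even n), (hOdd n).trans (csch_even n)⟩,
    ⟨_, (hmap _ hsec.1).1, fun n => ⟨((hmap _ hsec.1).2 n).1,
      (hEven n).trans ((hmap _ hsec.1).2 n).2⟩⟩,
    ⟨_, (hmap _ hcsc.1).1, fun n => ⟨((hmap _ hcsc.1).2 n).1,
      (hOdd n).trans ((hmap _ hcsc.1).2 n).2⟩⟩⟩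
end
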